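/- The test element of the rank-7 example: With M₁, …, M₇ the seven explicit matrices listed in the context, the matrix X := M₁ + M₅ − 3·M₆ + 2·M₇ is symmetric and satisfies X² = 15·X. Consequently, viewed as a real matrix, X is positive semidefinite and its eigenvalues all lie in {0, 15}. -/

import Mathlib

def M₁ : Matrix (Fin 7) (Fin 7) ℝ := 1

def M₂ : Matrix (Fin 7) (Fin 7) ℝ :=
  !![0,1,0,0,0,0,0; 1,1,0,1,0,1,1; 0,0,1,0,1,1,1; 0,1,0,0,1,1,1;
     0,0,1,1,1,1,1; 0,1,1,1,1,1,1; 0,1,1,1,1,1,1]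

def M₃ : Matrix (Fin 7) (Fin 7) ℝ :=
  !![0,0,1,0,0,0,0; 0,0,1,0,1,1,1; 1,1,1,0,0,1,1; 0,0,0,1,1,1,1;
     0,1,0,1,1,1,1; 0,1,1,1,1,1,1; 0,1,1,1,1,1,1]

def M₄ : Matrix (Fin 7) (Fin 7) ℝ :=
  !![0,0,0,1,0,0,0; 0,1,0,0,1,1,1; 0,0,0,1,1,1,1; 1,0,1,1,0,1,1;
     0,1,1,0,1,1,1; 0,1,1,1,1,1,1; 0,1,1,1,1,1,1]

def M₅ : Matrix (Fin 7) (Fin 7) ℝ :=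
  !![0,0,0,0,1,0,0; 0,0,1,1,1,1,1; 0,1,0,1,1,1,1; 0,1,1,0,1,1,1;
     1,1,1,1,1,1,1; 0,1,1,1,1,2,1; 0,1,1,1,1,1,2]

def M₆ : Matrix (Fin 7) (Fin 7) ℝ :=
  !![0,0,0,0,0,1,0; 0,1,1,1,1,1,1; 0,1,1,1,1,1,1; 0,1,1,1,1,1,1;
     0,1,1,1,1,2,1; 1,1,1,1,2,0,3; 0,1,1,1,1,3,1]

def M₇ : Matrix (Fin 7) (Fin 7) ℝ :=
  !![0,0,0,0,0,0,1; 0,1,1,1,1,1,1; 0,1,1,1,1,1,1; 0,1,1,1,1,1,1;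
     0,1,1,1,1,1,2; 0,1,1,1,1,3,1; 1,1,1,1,2,1,2]

/-- The seven fusion matrices of the rank-7 simple integral fusion ring. -/
def M : Fin 7 → Matrix (Fin 7) (Fin 7) ℝ := ![M₁, M₂, M₃, M₄, M₅, M₆, M₇]

/-- The test element `X = M₁ + M₅ − 3 M₆ + 2 M₇` of the rank-7 example. -/
noncomputable def X : Matrix (Fin 7) (Fin 7) ℝ := M₁ + M₅ - (3 : ℝ) • M₆ + (2 : ℝ) • M₇

/-- The vector spanning the range of the test element. -/
def testVector : Fin 7 → ℝ := ![1, 0, 0, 0, 1, -3, 2]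

theorem X_eq_vecMulVec : X = Matrix.vecMulVec testVector testVector := by
  ext i j
  fin_cases i <;> fin_cases j <;>
    norm_num [X, M₁, M₅, M₆, M₇, testVector, Matrix.vecMulVec_apply, Matrix.one_apply]

theorem testVector_dotProduct_self : testVector ⬝ᵥ testVector = 15 := by
  norm_num [testVector, dotProduct, Fin.sum_univ_succ]

open Matrix in
/-- The test element `X = M₁ + M₅ − 3 M₆ + 2 M₇` is symmetric and satisfies
`X² = 15 X`; consequently `X` is positive semidefinite and every eigenvalue of `X`
is `0` or `15`. -/
theorem rank7_test_element :
    Xᵀ = X ∧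
    X * X = (15 : ℝ) • X ∧
    X.PosSemidef ∧
    (∀ (μ : ℝ) (v : Fin 7 → ℝ), v ≠ 0 → X.mulVec v = μ • v → μ = 0 ∨ μ = 15) := by
  have hsq : X * X = (15 : ℝ) • X := by
    rw [X_eq_vecMulVec, vecMulVec_mul_vecMulVec, testVector_dotProduct_self, vecMulVec_smul]
  refine ⟨?_, hsq, ?_, fun μ v hv h => ?_⟩
  · rw [X_eq_vecMulVec, transpose_vecMulVec]
  · rw [X_eq_vecMulVec]
    simpa using posSemidef_vecMulVec_self_star testVector
  · have hμ : (μ * μ) • v = (15 * μ) • v := by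
      rw [mul_smul, mul_smul, ← h, ← mulVec_smul, ← h, mulVec_mulVec, hsq, smul_mulVec]
    have hroot : μ * (μ - 15) = 0 := by
      linarith [smul_left_injective ℝ hv hμ]
    simpa [sub_eq_zero] using hroot
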